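/- Consider the problem −Δu = λ·e^{2u} on the open unit disk B₁ ⊂ ℝ² with u = 0 on ∂B₁ and λ > 0. Then a positive smooth classical solution exists for every λ ∈ (0, 1], and no positive smooth classical solution exists for any λ > 1; that is, the extremal parameter of this Gelfand problem is λ* = 1. -/

import Mathlib

open Metric Real

/-- The Euclidean Laplacian of a function on `ℝⁿ`, as the sum of pure second
derivatives in the coordinate directions. -/
noncomputable def laplacian {n : ℕ} (u : EuclideanSpace ℝ (Fin n) → ℝ)
    (x : EuclideanSpace ℝ (Fin n)) : ℝ :=
  ∑ i : Fin n, iteratedFDeriv ℝ 2 u x ![EuclideanSpace.single i 1, EuclideanSpace.single i 1]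

/-- `u` is a positive smooth classical solution of `-Δu = λ e^{2u}` on the unit
disk of `ℝ²` with `u = 0` on the unit circle. -/
def IsGelfandSol2 (lam : ℝ) (u : EuclideanSpace ℝ (Fin 2) → ℝ) : Prop :=
  ContDiff ℝ (⊤ : ℕ∞) u ∧
  (∀ x ∈ ball (0 : EuclideanSpace ℝ (Fin 2)) 1, 0 < u x) ∧
  (∀ x ∈ ball (0 : EuclideanSpace ℝ (Fin 2)) 1,
    -laplacian u x = lam * Real.exp (2 * u x)) ∧
  (∀ x ∈ sphere (0 : EuclideanSpace ℝ (Fin 2)) 1, u x = 0)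

open scoped InnerProductSpace

/-- The Euclidean plane. -/
abbrev Plane := EuclideanSpace ℝ (Fin 2)

lemma hasFDerivAt_fderiv_apply {u : Plane → ℝ} (hu : ContDiff ℝ (⊤ : ℕ∞) u) (x b : Plane) :
    HasFDerivAt (fun y => fderiv ℝ u y b)
      ((fderiv ℝ (fderiv ℝ u) x).flip b) x := by
  have h1 : Differentiable ℝ (fderiv ℝ u) :=
    (hu.fderiv_right (m := 1) (by norm_cast)).differentiable (by norm_num)
  have h2 := (h1 x).hasFDerivAt.clm_apply (hasFDerivAt_const b x)
  exact h2.congr_fderiv (by simp)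

/-- The radial function `log (1 + a) - log (1 + a ‖x‖²)`. -/
noncomputable def bubble (a : ℝ) (x : Plane) : ℝ :=
  Real.log (1 + a) - Real.log (1 + a * ‖x‖ ^ 2)

lemma one_add_mul_sq_pos {a : ℝ} (ha : 0 ≤ a) (x : Plane) : 0 < 1 + a * ‖x‖ ^ 2 := by positivity

lemma contDiff_bubble {a : ℝ} (ha : 0 ≤ a) : ContDiff ℝ (⊤ : ℕ∞) (bubble a) := by
  unfold bubble
  refine contDiff_const.sub (ContDiff.log ?_ fun x => (one_add_mul_sq_pos ha x).ne')
  exact contDiff_const.add (contDiff_const.mul (contDiff_norm_sq ℝ))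

lemma hasFDerivAt_one_add_mul_norm_sq (a : ℝ) (x : Plane) :
    HasFDerivAt (fun y : Plane => 1 + a * ‖y‖ ^ 2) ((2 * a) • innerSL ℝ x) x := by
  have h := ((hasStrictFDerivAt_norm_sq x).hasFDerivAt.const_mul a).const_add 1
  exact h.congr_fderiv (by ext y; simp; ring)

lemma fderiv_bubble {a : ℝ} (ha : 0 ≤ a) (x h : Plane) :
    fderiv ℝ (bubble a) x h = -(2 * a * ⟪x, h⟫_ℝ / (1 + a * ‖x‖ ^ 2)) := by
  have h1 := ((hasFDerivAt_one_add_mul_norm_sq a x).log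
    (one_add_mul_sq_pos ha x).ne').const_sub (Real.log (1 + a))
  have h2 : fderiv ℝ (bubble a) x = _ := h1.fderiv
  rw [h2]
  simp
  ring

lemma fderiv_fderiv_bubble {a : ℝ} (ha : 0 ≤ a) (x h : Plane) :
    fderiv ℝ (fderiv ℝ (bubble a)) x h h =
      -(2 * a * ‖h‖ ^ 2 / (1 + a * ‖x‖ ^ 2))
        + (2 * a * ⟪x, h⟫_ℝ / (1 + a * ‖x‖ ^ 2)) ^ 2 := by
  have h0 := (hasFDerivAt_fderiv_apply (contDiff_bubble ha) x h).fderiv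
  simp_rw [fderiv_bubble ha, div_eq_mul_inv] at h0
  have hne := (one_add_mul_sq_pos ha x).ne'
  have h1 : HasFDerivAt (fun y : Plane => ⟪y, h⟫_ℝ) (innerSL ℝ h) x := by
    have := (innerSL ℝ h).hasFDerivAt (x := x)
    convert this using 2 with y
    simp [real_inner_comm]
  have h2 : HasFDerivAt (fun y : Plane => -(2 * a * ⟪y, h⟫_ℝ * (1 + a * ‖y‖ ^ 2)⁻¹)) _ x :=
    ((h1.const_mul (2 * a)).mul
      ((hasDerivAt_inv hne).comp_hasFDerivAt x (hasFDerivAt_one_add_mul_norm_sq a x))).fun_neg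
  rw [h2.fderiv] at h0
  have h3 := congrArg (fun L : Plane →L[ℝ] ℝ => L h) h0
  simp only [ContinuousLinearMap.flip_apply] at h3
  rw [← h3]
  simp
  field_simp

lemma laplacian_eq (u : Plane → ℝ) (x : Plane) : laplacian u x =
    fderiv ℝ (fderiv ℝ u) x (EuclideanSpace.single 0 1) (EuclideanSpace.single 0 1) +
    fderiv ℝ (fderiv ℝ u) x (EuclideanSpace.single 1 1) (EuclideanSpace.single 1 1) := by
  simp [laplacian, Fin.sum_univ_two, iteratedFDeriv_two_apply]

lemma laplacian_sub {u v : Plane → ℝ} (hu : ContDiff ℝ (⊤ : ℕ∞) u) (hv : ContDiff ℝ (⊤ : ℕ∞) v)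
    (x : Plane) : laplacian (fun y => u y - v y) x = laplacian u x - laplacian v x := by
  have h1 : fderiv ℝ (fun y => u y - v y) = fun y => fderiv ℝ u y - fderiv ℝ v y := by
    ext1 y
    exact fderiv_fun_sub (hu.differentiable (by simp) y) (hv.differentiable (by simp) y)
  have hd : ∀ {w : Plane → ℝ}, ContDiff ℝ (⊤ : ℕ∞) w → Differentiable ℝ (fderiv ℝ w) := fun hw =>
    (hw.fderiv_right (m := 1) (by norm_cast)).differentiable (by norm_num)
  rw [laplacian_eq, laplacian_eq, laplacian_eq, h1, fderiv_fun_sub (hd hu x) (hd hv x)]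
  simp
  ring

lemma laplacian_bubble {a : ℝ} (ha : 0 ≤ a) (x : Plane) :
    laplacian (bubble a) x = -(4 * a / (1 + a * ‖x‖ ^ 2) ^ 2) := by
  have hne := (one_add_mul_sq_pos ha x).ne'
  have hx : ‖x‖ ^ 2 = x 0 ^ 2 + x 1 ^ 2 := by
    rw [EuclideanSpace.norm_sq_eq]; simp [Fin.sum_univ_two]
  rw [laplacian_eq, fderiv_fderiv_bubble ha, fderiv_fderiv_bubble ha]
  simp only [EuclideanSpace.inner_single_right, PiLp.norm_single]
  rw [hx] at hne ⊢
  simp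
  field_simp
  ring

lemma exp_two_mul_bubble {a : ℝ} (ha : 0 ≤ a) (x : Plane) :
    Real.exp (2 * bubble a x) = ((1 + a) / (1 + a * ‖x‖ ^ 2)) ^ 2 := by
  have h1 : 0 < 1 + a := by linarith
  rw [bubble, ← Real.log_div h1.ne' (one_add_mul_sq_pos ha x).ne', mul_comm, Real.exp_mul,
    Real.exp_log (div_pos h1 (one_add_mul_sq_pos ha x))]
  norm_cast

lemma isGelfandSol2_bubble {a : ℝ} (ha : 0 < a) :
    IsGelfandSol2 (4 * a / (1 + a) ^ 2) (bubble a) := by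
  refine ⟨contDiff_bubble ha.le, fun x hx => ?_, fun x _ => ?_, fun x hx => ?_⟩
  · rw [mem_ball_zero_iff] at hx
    refine sub_pos.2 (Real.log_lt_log (one_add_mul_sq_pos ha.le x) ?_)
    have : ‖x‖ ^ 2 < 1 := pow_lt_one₀ (norm_nonneg x) hx two_ne_zero
    nlinarith
  · have h2 := (one_add_mul_sq_pos ha.le x).ne'
    have h1 : 1 + a ≠ 0 := by positivity
    rw [laplacian_bubble ha.le, exp_two_mul_bubble ha.le]
    field_simp
  · rw [mem_sphere_zero_iff_norm] at hx
    simp [bubble, hx]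

lemma exists_pos_parameter {lam : ℝ} (h0 : 0 < lam) (h1 : lam ≤ 1) :
    ∃ a : ℝ, 0 < a ∧ 4 * a / (1 + a) ^ 2 = lam := by
  set s := Real.sqrt (1 - lam) with hs
  have hs0 : 0 ≤ s := Real.sqrt_nonneg _
  have hs2 : s ^ 2 = 1 - lam := Real.sq_sqrt (by linarith)
  have hs1 : s < 1 := by nlinarith
  have hp : 1 + s ≠ 0 := by positivity
  refine ⟨(1 - s) / (1 + s), div_pos (by linarith) (by positivity), ?_⟩
  have : 1 + (1 - s) / (1 + s) = 2 / (1 + s) := by field_simp; ring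
  rw [this]
  field_simp
  linarith

/-- The unit radial vector at angle `θ`. -/
noncomputable def radialVec (θ : ℝ) : Plane :=
  Real.cos θ • EuclideanSpace.single 0 1 + Real.sin θ • EuclideanSpace.single 1 1

/-- The unit angular vector at angle `θ`. -/
noncomputable def angularVec (θ : ℝ) : Plane :=
  (-Real.sin θ) • EuclideanSpace.single 0 1 + Real.cos θ • EuclideanSpace.single 1 1

lemma hasDerivAt_radialVec (θ : ℝ) : HasDerivAt radialVec (angularVec θ) θ :=
  ((Real.hasDerivAt_cos θ).smul_const _).add ((Real.hasDerivAt_sin θ).smul_const _)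

lemma hasDerivAt_angularVec (θ : ℝ) : HasDerivAt angularVec (-radialVec θ) θ := by
  have h := ((Real.hasDerivAt_sin θ).neg.smul_const (EuclideanSpace.single 0 1 : Plane)).add
    ((Real.hasDerivAt_cos θ).smul_const (EuclideanSpace.single 1 1 : Plane))
  exact h.congr_deriv (by simp [radialVec]; abel)

lemma norm_radialVec (θ : ℝ) : ‖radialVec θ‖ = 1 := by
  rw [EuclideanSpace.norm_eq]
  simp [radialVec, Fin.sum_univ_two]

lemma norm_smul_radialVec {r : ℝ} (hr : 0 ≤ r) (θ : ℝ) : ‖r • radialVec θ‖ = r := by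
  rw [norm_smul, norm_radialVec, mul_one, Real.norm_of_nonneg hr]

lemma fderiv_fderiv_radial_add_angular (u : Plane → ℝ) (x : Plane) (θ : ℝ) :
    fderiv ℝ (fderiv ℝ u) x (radialVec θ) (radialVec θ) +
      fderiv ℝ (fderiv ℝ u) x (angularVec θ) (angularVec θ) = laplacian u x := by
  rw [laplacian_eq]
  simp only [radialVec, angularVec, map_add, map_smul, add_apply,
    smul_apply, smul_eq_mul]
  linear_combination
    (fderiv ℝ (fderiv ℝ u) x (EuclideanSpace.single 0 1) (EuclideanSpace.single 0 1) +
      fderiv ℝ (fderiv ℝ u) x (EuclideanSpace.single 1 1) (EuclideanSpace.single 1 1)) *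
      Real.sin_sq_add_cos_sq θ

lemma hasDerivAt_fderiv_apply {w : Plane → ℝ} (hw : ContDiff ℝ (⊤ : ℕ∞) w) {γ τ : ℝ → Plane}
    {γ' τ' : Plane} {t : ℝ} (hγ : HasDerivAt γ γ' t) (hτ : HasDerivAt τ τ' t) :
    HasDerivAt (fun s => fderiv ℝ w (γ s) (τ s))
      (fderiv ℝ (fderiv ℝ w) (γ t) γ' (τ t) + fderiv ℝ w (γ t) τ') t := by
  have hD : Differentiable ℝ (fderiv ℝ w) :=
    (hw.fderiv_right (m := 1) (by norm_cast)).differentiable (by norm_num)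
  have h : HasDerivAt (fun s => fderiv ℝ w (γ s)) (fderiv ℝ (fderiv ℝ w) (γ t) γ') t :=
    (hD (γ t)).hasFDerivAt.comp_hasDerivAt t hγ
  exact h.clm_apply hτ

/-- Green's identity on the unit disk in polar coordinates, for a function `w` vanishing on the
circle and a radial function `φ` with `φ 1 = 0`. -/
lemma integral_green_radial {w : Plane → ℝ} (hw : ContDiff ℝ (⊤ : ℕ∞) w)
    (hw0 : ∀ x ∈ sphere (0 : Plane) 1, w x = 0) {φ φ' φ'' : ℝ → ℝ}
    (hφ : ∀ r, HasDerivAt φ (φ' r) r) (hφ' : ∀ r, HasDerivAt φ' (φ'' r) r)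
    (hφ'' : Continuous φ'') (hφ1 : φ 1 = 0) :
    ∫ r in (0 : ℝ)..1, ∫ θ in (0 : ℝ)..2 * π,
      (r * φ r * laplacian w (r • radialVec θ)
        - w (r • radialVec θ) * (φ' r + r * φ'' r)) = 0 := by
  have hφc : Continuous φ := continuous_iff_continuousAt.2 fun r => (hφ r).continuousAt
  have hφc' : Continuous φ' := continuous_iff_continuousAt.2 fun r => (hφ' r).continuousAt
  have hec : Continuous radialVec :=
    continuous_iff_continuousAt.2 fun r => (hasDerivAt_radialVec r).continuousAt
  have htc : Continuous angularVec :=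
    continuous_iff_continuousAt.2 fun r => (hasDerivAt_angularVec r).continuousAt
  have hwc : Continuous w := hw.continuous
  have hD : ContDiff ℝ 1 (fderiv ℝ w) := hw.fderiv_right (m := 1) (by norm_cast)
  have hDc : Continuous (fderiv ℝ w) := hD.continuous
  have hDDc : Continuous (fderiv ℝ (fderiv ℝ w)) := hD.continuous_fderiv (by norm_num)
  have hwd : ∀ x, HasFDerivAt w (fderiv ℝ w x) x := fun x =>
    (hw.differentiable (by simp) x).hasFDerivAt
  set A : ℝ → ℝ → ℝ := fun r θ =>
    φ r * fderiv ℝ w (r • radialVec θ) (radialVec θ) - w (r • radialVec θ) * φ' r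
      + r * (φ r * fderiv ℝ (fderiv ℝ w) (r • radialVec θ) (radialVec θ) (radialVec θ)
        - w (r • radialVec θ) * φ'' r) with hA
  set B : ℝ → ℝ → ℝ := fun r θ =>
    φ r * (r * fderiv ℝ (fderiv ℝ w) (r • radialVec θ) (angularVec θ) (angularVec θ)
      - fderiv ℝ w (r • radialVec θ) (radialVec θ)) with hB
  have hAc : Continuous (Function.uncurry A) := by
    simp only [hA, Function.uncurry_def]; fun_prop
  have hBc : Continuous (Function.uncurry B) := by
    simp only [hB, Function.uncurry_def]; fun_prop
  have hray : ∀ r θ : ℝ, HasDerivAt (fun s : ℝ => s • radialVec θ) (radialVec θ) r := fun r θ => by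
    simpa using (hasDerivAt_id r).smul_const (radialVec θ)
  have hcirc : ∀ r θ : ℝ, HasDerivAt (fun s : ℝ => r • radialVec s) (r • angularVec θ) θ :=
    fun r θ => (hasDerivAt_radialVec θ).const_smul r
  have hAint : ∀ θ : ℝ, ∫ r in (0 : ℝ)..1, A r θ = 0 := fun θ => by
    have hd : ∀ r : ℝ, HasDerivAt (fun r => r * (φ r * fderiv ℝ w (r • radialVec θ) (radialVec θ)
        - w (r • radialVec θ) * φ' r)) (A r θ) r := fun r => by
      have h1 : HasDerivAt (fun s : ℝ => w (s • radialVec θ)) _ r :=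
        (hwd (r • radialVec θ)).comp_hasDerivAt r (hray r θ)
      have h2 := hasDerivAt_fderiv_apply hw (hray r θ) (hasDerivAt_const r (radialVec θ))
      have h3 := (hasDerivAt_id' r).fun_mul (((hφ r).fun_mul h2).fun_sub (h1.fun_mul (hφ' r)))
      exact h3.congr_deriv (by simp only [hA, map_zero]; ring)
    rw [intervalIntegral.integral_eq_sub_of_hasDerivAt (fun r _ => hd r)
      ((hAc.comp (Continuous.prodMk_left θ)).intervalIntegrable _ _)]
    have : w ((1 : ℝ) • radialVec θ) = 0 := hw0 _ (by simp [norm_radialVec])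
    simp only [this, hφ1]
    simp
  have hBint : ∀ r : ℝ, ∫ θ in (0 : ℝ)..2 * π, B r θ = 0 := fun r => by
    have hd : ∀ θ : ℝ, HasDerivAt
        (fun θ => φ r * fderiv ℝ w (r • radialVec θ) (angularVec θ)) (B r θ) θ := fun θ => by
      have h2 := hasDerivAt_fderiv_apply hw (hcirc r θ) (hasDerivAt_angularVec θ)
      exact (h2.const_mul (φ r)).congr_deriv (by
        simp only [hB, map_neg, map_smul, smul_apply, smul_eq_mul]; ring)
    rw [intervalIntegral.integral_eq_sub_of_hasDerivAt (fun r _ => hd r)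
      ((hBc.comp (Continuous.prodMk_right r)).intervalIntegrable _ _)]
    simp [radialVec, angularVec]
  have hAB : ∀ r θ, r * φ r * laplacian w (r • radialVec θ)
        - w (r • radialVec θ) * (φ' r + r * φ'' r) = A r θ + B r θ := fun r θ => by
    rw [← fderiv_fderiv_radial_add_angular w _ θ]
    simp only [hA, hB]
    ring
  have hsum : ∀ r : ℝ, ∫ θ in (0 : ℝ)..2 * π, (A r θ + B r θ) = ∫ θ in (0 : ℝ)..2 * π, A r θ :=
    fun r => by
      have hAr : Continuous (A r) := hAc.comp (Continuous.prodMk_right r)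
      have hBr : Continuous (B r) := hBc.comp (Continuous.prodMk_right r)
      rw [intervalIntegral.integral_add (hAr.intervalIntegrable _ _)
        (hBr.intervalIntegrable _ _), hBint, add_zero]
  simp_rw [hAB, hsum]
  rw [MeasureTheory.intervalIntegral_intervalIntegral_swap
    ((hAc.continuousOn.integrableOn_compact (isCompact_uIcc.prod isCompact_uIcc)).mono_set
      (Set.prod_mono Set.uIoc_subset_uIcc Set.uIoc_subset_uIcc))]
  simp [hAint]

lemma continuous_laplacian {w : Plane → ℝ} (hw : ContDiff ℝ (⊤ : ℕ∞) w) :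
    Continuous (laplacian w) := by
  have hD : ContDiff ℝ 1 (fderiv ℝ w) := hw.fderiv_right (m := 1) (by norm_cast)
  have hDDc : Continuous (fderiv ℝ (fderiv ℝ w)) := hD.continuous_fderiv (by norm_num)
  rw [funext (laplacian_eq w)]
  fun_prop

lemma hasDerivAt_one_sub_sq_div_one_add_sq (r : ℝ) :
    HasDerivAt (fun r : ℝ => (1 - r ^ 2) / (1 + r ^ 2)) (-(4 * r) / (1 + r ^ 2) ^ 2) r := by
  have hne : 1 + r ^ 2 ≠ 0 := by positivity
  refine (((hasDerivAt_pow 2 r).const_sub 1).fun_div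
    ((hasDerivAt_pow 2 r).const_add 1) hne).congr_deriv ?_
  field_simp
  push_cast
  ring

lemma hasDerivAt_neg_four_mul_div_one_add_sq_sq (r : ℝ) :
    HasDerivAt (fun r : ℝ => -(4 * r) / (1 + r ^ 2) ^ 2)
      ((12 * r ^ 2 - 4) / (1 + r ^ 2) ^ 3) r := by
  have hne : 1 + r ^ 2 ≠ 0 := by positivity
  refine ((((hasDerivAt_id r).const_mul 4).fun_neg).fun_div
    (((hasDerivAt_pow 2 r).const_add 1).fun_pow 2) (pow_ne_zero 2 hne)).congr_deriv ?_
  simp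
  field_simp
  ring

/-- Every function `w` vanishing on the unit circle satisfies `-Δw ≤ 8 w / (1 + ‖x‖²)²` somewhere
in the open unit disk. -/
lemma exists_neg_laplacian_le {w : Plane → ℝ} (hw : ContDiff ℝ (⊤ : ℕ∞) w)
    (hw0 : ∀ x ∈ sphere (0 : Plane) 1, w x = 0) :
    ∃ x ∈ ball (0 : Plane) 1, -laplacian w x ≤ 8 / (1 + ‖x‖ ^ 2) ^ 2 * w x := by
  by_contra! hlt
  have hec : Continuous radialVec :=
    continuous_iff_continuousAt.2 fun r => (hasDerivAt_radialVec r).continuousAt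
  have hwc : Continuous w := hw.continuous
  have hLc := continuous_laplacian hw
  have hφ''c : Continuous fun r : ℝ => (12 * r ^ 2 - 4) / (1 + r ^ 2) ^ 3 :=
    Continuous.div (by fun_prop) (by fun_prop) fun r => by positivity
  have hgreen := integral_green_radial hw hw0 hasDerivAt_one_sub_sq_div_one_add_sq
    hasDerivAt_neg_four_mul_div_one_add_sq_sq hφ''c (by norm_num)
  set f : ℝ → ℝ → ℝ := fun r θ =>
    r * ((1 - r ^ 2) / (1 + r ^ 2)) * laplacian w (r • radialVec θ) - w (r • radialVec θ) *
      (-(4 * r) / (1 + r ^ 2) ^ 2 + r * ((12 * r ^ 2 - 4) / (1 + r ^ 2) ^ 3)) with hf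
  have hfc : Continuous (Function.uncurry f) := by
    simp only [hf, Function.uncurry_def]
    fun_prop (disch := intro; positivity)
  have hneg : ∀ r ∈ Set.Ioo (0 : ℝ) 1, ∀ θ, f r θ < 0 := fun r hr θ => by
    have hnorm := norm_smul_radialVec hr.1.le θ
    have h := hlt (r • radialVec θ) (by rw [mem_ball_zero_iff, hnorm]; exact hr.2)
    rw [hnorm] at h
    have hne : 1 + r ^ 2 ≠ 0 := by positivity
    have hpos : 0 < r * ((1 - r ^ 2) / (1 + r ^ 2)) :=
      mul_pos hr.1 (div_pos (by nlinarith [hr.1, hr.2]) (by positivity))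
    have : f r θ = r * ((1 - r ^ 2) / (1 + r ^ 2)) * (laplacian w (r • radialVec θ)
        + 8 / (1 + r ^ 2) ^ 2 * w (r • radialVec θ)) := by
      simp only [hf]
      field_simp
      ring
    rw [this]
    exact mul_neg_of_pos_of_neg hpos (by linarith)
  have hint : Continuous fun r => ∫ θ in (0 : ℝ)..2 * π, f r θ :=
    intervalIntegral.continuous_parametric_intervalIntegral_of_continuous' hfc _ _
  have hpos : 0 < ∫ r in (0 : ℝ)..1, -∫ θ in (0 : ℝ)..2 * π, f r θ := by
    refine intervalIntegral.intervalIntegral_pos_of_pos_on (hint.neg.intervalIntegrable _ _)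
      (fun r hr => ?_) one_pos
    rw [← intervalIntegral.integral_neg]
    exact intervalIntegral.intervalIntegral_pos_of_pos_on
      ((by fun_prop : Continuous fun θ => -f r θ).intervalIntegrable _ _)
      (fun θ _ => neg_pos.2 (hneg r hr θ)) two_pi_pos
  rw [intervalIntegral.integral_neg, hgreen] at hpos
  simp at hpos

lemma not_isGelfandSol2_of_one_lt {lam : ℝ} (hlam : 1 < lam) (u : Plane → ℝ) :
    ¬ IsGelfandSol2 lam u := by
  rintro ⟨hu, -, heq, hu0⟩
  have hv := contDiff_bubble zero_le_one
  obtain ⟨x, hx, hle⟩ := exists_neg_laplacian_le (hu.sub hv) fun x hx => by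
    have : ‖x‖ = 1 := by simpa using hx
    simp [hu0 x hx, bubble, this]
  have hlap := laplacian_sub hu hv x
  have hΔv := laplacian_bubble zero_le_one x
  have hexp := exp_two_mul_bubble zero_le_one x
  have hΔu := heq x hx
  have hne := (one_add_mul_sq_pos zero_le_one x).ne'
  have hconv := Real.add_one_le_exp (2 * (u x - bubble 1 x))
  have hsplit : Real.exp (2 * u x) =
      Real.exp (2 * bubble 1 x) * Real.exp (2 * (u x - bubble 1 x)) := by
    rw [← Real.exp_add]; ring_nf
  have hmul := mul_le_mul_of_nonneg_left hconv (Real.exp_pos (2 * bubble 1 x)).le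
  rw [← hsplit] at hmul
  have hstrict : Real.exp (2 * u x) < lam * Real.exp (2 * u x) := by
    nlinarith [Real.exp_pos (2 * u x)]
  have h4 : Real.exp (2 * bubble 1 x) = 4 / (1 + ‖x‖ ^ 2) ^ 2 := by
    rw [hexp, one_mul, div_pow]; norm_num
  have h8 : 8 / (1 + ‖x‖ ^ 2) ^ 2 = 2 * Real.exp (2 * bubble 1 x) := by
    rw [h4]; ring
  rw [one_mul, mul_one, ← h4] at hΔv
  rw [h8] at hle
  change -laplacian (fun y => u y - bubble 1 y) x ≤ _ * (u x - bubble 1 x) at hle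
  rw [hlap, hΔv] at hle
  linarith

/-- The extremal parameter of the Gelfand problem `-Δu = λ e^{2u}` on the unit
disk is `λ* = 1`: solutions exist for `0 < λ ≤ 1` and for no `λ > 1`. -/
theorem stmt_18 :
    (∀ lam : ℝ, 0 < lam → lam ≤ 1 →
      ∃ u : EuclideanSpace ℝ (Fin 2) → ℝ, IsGelfandSol2 lam u) ∧
    (∀ lam : ℝ, 1 < lam →
      ¬ ∃ u : EuclideanSpace ℝ (Fin 2) → ℝ, IsGelfandSol2 lam u) := by
  refine ⟨fun lam h0 h1 => ?_, fun lam h ⟨u, hu⟩ => not_isGelfandSol2_of_one_lt h u hu⟩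
  obtain ⟨a, ha, rfl⟩ := exists_pos_parameter h0 h1
  exact ⟨bubble a, isGelfandSol2_bubble ha⟩
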